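/- Splitting of the slice Cauchy kernel on a slice plane: Let q = q₀ + I_q ζ ∈ ℝ^{m+1}_* with ζ = |q̱| > 0, let I ∈ 𝕊, and set q_{±I} = q₀ ± Iζ, α = (1 − I_q I)/2, β = (1 + I_q I)/2. Then for every x ∈ ℂ_I with x ∉ {q_I, q_{−I}}, the slice Cauchy kernel satisfies S^{-1}(q,x) = α (x − q_I)^{-1} + β (x − q_{−I})^{-1}, where (x − q_{±I})^{-1} is the inverse taken in the plane ℂ_I (identified with ℂ). -/

import Mathlib

open MeasureTheory Filter Metric Topology ComplexConjugate CliffordAlgebra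
open scoped ENNReal NNReal Real

noncomputable section

/-- The negative definite quadratic form `-(x₁² + ⋯ + x_m²)` on `ℝ^m`, so that the generators
`e_i` of its Clifford algebra satisfy `e_i e_j + e_j e_i = -2 δ_{ij}`. -/
def clQ (m : ℕ) : QuadraticForm ℝ (Fin m → ℝ) :=
  QuadraticMap.weightedSumSquares ℝ (fun _ : Fin m => (-1 : ℝ))

/-- The real Clifford algebra `Cl_{0,m}`. -/
abbrev Cl (m : ℕ) := CliffordAlgebra (clQ m)

/-- The paravector space `ℝ^{m+1}`, coordinate `0` being the real part. -/
abbrev Vp (m : ℕ) := EuclideanSpace ℝ (Fin (m + 1))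

variable {m : ℕ} {A : Type*}

/-- Real part `x₀` of a paravector. -/
def pre (x : Vp m) : ℝ := x 0

/-- Vector part `x̲` of a paravector. -/
def pvec (x : Vp m) : EuclideanSpace ℝ (Fin m) :=
  (EuclideanSpace.equiv (Fin m) ℝ).symm (fun i => x i.succ)

/-- The sphere `𝕊` of unit `1`-vectors, as a subset of `ℝ^m`. -/
def uS (m : ℕ) : Set (EuclideanSpace ℝ (Fin m)) := Metric.sphere 0 1

/-- The upper half sphere `𝕊⁺ = {x ∈ 𝕊 : x_m > 0}`. -/
def uShalf (m : ℕ) : Set (EuclideanSpace ℝ (Fin m)) :=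
  {v | ‖v‖ = 1 ∧ ∃ i : Fin m, (i : ℕ) + 1 = m ∧ 0 < v i}

/-- `Φ_J(u + iv) = u + Jv` as a paravector. -/
def PhiJ (J : EuclideanSpace ℝ (Fin m)) (z : ℂ) : Vp m :=
  (EuclideanSpace.equiv (Fin (m + 1)) ℝ).symm (Fin.cons z.re (fun i => z.im * J i))

/-- The axially symmetric set `Ω_D = ⋃_{J ∈ 𝕊} Φ_J(D)`. -/
def axSym (m : ℕ) (D : Set ℂ) : Set (Vp m) := ⋃ J ∈ uS m, PhiJ J '' D

/-- The set `ℝ^{m+1}_* = ℝ^{m+1} ∖ ℝ` of nonreal paravectors. -/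
def VpStar (m : ℕ) : Set (Vp m) := {x | pvec x ≠ 0}

/-- The slice plane `ℂ_I`, i.e. the plane spanned by `1` and `I` inside `ℝ^{m+1}`. -/
def planeC (I : EuclideanSpace ℝ (Fin m)) : Set (Vp m) := Set.range (PhiJ I)

/-- `Ω_D` is a bounded axially symmetric domain contained in `ℝ^{m+1}_*`, induced by the
conjugation-invariant plane domain `D`. -/
def IsBddAxSymDomain (m : ℕ) (D : Set ℂ) (Ω : Set (Vp m)) : Prop :=
  IsOpen D ∧ (∀ z ∈ D, conj z ∈ D) ∧ Ω = axSym m D ∧ IsConnected Ω ∧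
    Bornology.IsBounded Ω ∧ Ω ⊆ VpStar m

/-- The area `ω_{m-1}` of the unit `(m-1)`-sphere `𝕊 ⊆ ℝ^m`, as an `(m-1)`-dimensional
Hausdorff measure. -/
def sphereArea (m : ℕ) : ℝ :=
  (μH[(m : ℝ) - 1] (Metric.sphere (0 : EuclideanSpace ℝ (Fin m)) 1)).toReal

/-- A smooth bounded domain description: `ρ` is a smooth defining function of `Ω` with
nonvanishing gradient on the (smooth) boundary. -/
def IsSmoothBoundary (Ω : Set (Vp m)) (ρ : Vp m → ℝ) : Prop :=
  ContDiff ℝ (⊤ : ℕ∞) ρ ∧ Ω = {x | ρ x < 0} ∧ frontier Ω = {x | ρ x = 0} ∧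
    ∀ x ∈ frontier Ω, gradient ρ x ≠ 0

/-- The outward unit normal vector to the boundary, computed from a defining function. -/
def outNormal (ρ : Vp m → ℝ) (x : Vp m) : Vp m := ‖gradient ρ x‖⁻¹ • gradient ρ x

section Algebra
variable [Ring A] [Algebra ℝ A]

/-- The `1`-vector `v ∈ ℝ^m ⊆ Cl_m`, realized in `A`. -/
def ιvA (Ψ : Cl m ≃ₐ[ℝ] A) (v : EuclideanSpace ℝ (Fin m)) : A :=
  Ψ (CliffordAlgebra.ι (clQ m) (fun i => v i))

/-- A paravector `x = x₀ + x̲`, realized in `A`. -/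
def embA (Ψ : Cl m ≃ₐ[ℝ] A) (x : Vp m) : A := algebraMap ℝ A (pre x) + ιvA Ψ (pvec x)

/-- The conjugate paravector `x̄ = x₀ - x̲`, realized in `A`. -/
def embConjA (Ψ : Cl m ≃ₐ[ℝ] A) (x : Vp m) : A := algebraMap ℝ A (pre x) - ιvA Ψ (pvec x)

/-- A complex number `u + iv` realized in the slice plane `ℂ_I ⊆ A`. -/
def embC (Ψ : Cl m ≃ₐ[ℝ] A) (I : EuclideanSpace ℝ (Fin m)) (z : ℂ) : A :=
  algebraMap ℝ A z.re + z.im • ιvA Ψ I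

/-- The Clifford conjugation `x ↦ x̄` on `A` (reversion composed with the grade involution). -/
def cconjA (Ψ : Cl m ≃ₐ[ℝ] A) (a : A) : A :=
  Ψ (CliffordAlgebra.reverse (CliffordAlgebra.involute (Ψ.symm a)))

/-- `F = F₁ + i F₂` is a stem function on a conjugation-invariant set `D ⊆ ℂ`. -/
def IsStem (D : Set ℂ) (F1 F2 : ℂ → A) : Prop :=
  ∀ z ∈ D, F1 (conj z) = F1 z ∧ F2 (conj z) = -F2 z

/-- `f` is the slice function on `Ω_D` induced by a stem function: for all `z = u+iv ∈ D`
and `J ∈ 𝕊`, `f(u + Jv) = F₁(z) + J F₂(z)`. -/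
def IsSliceOn (Ψ : Cl m ≃ₐ[ℝ] A) (D : Set ℂ) (f : Vp m → A) : Prop :=
  ∃ F1 F2 : ℂ → A, IsStem D F1 F2 ∧
    ∀ z ∈ D, ∀ J ∈ uS m, f (PhiJ J z) = F1 z + ιvA Ψ J * F2 z

/-- The slice Cauchy kernel `S^{-1}(q,x) = -(q² - 2 Re[x] q + |x|²)⁻¹ (q - x̄)`. -/
def Skernel (Ψ : Cl m ≃ₐ[ℝ] A) (q x : Vp m) : A :=
  -(Ring.inverse (embA Ψ q ^ 2 - (2 * pre x) • embA Ψ q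
      + algebraMap ℝ A (pre x ^ 2 + ‖pvec x‖ ^ 2)) * (embA Ψ q - embConjA Ψ x))

end Algebra

section Analytic
variable [NormedRing A] [NormedAlgebra ℝ A] [MeasurableSpace A] [BorelSpace A]

/-- `f` is a slice function with `C¹` stem components. -/
def IsSlice1On (Ψ : Cl m ≃ₐ[ℝ] A) (D : Set ℂ) (f : Vp m → A) : Prop :=
  ∃ F1 F2 : ℂ → A, IsStem D F1 F2 ∧ ContDiffOn ℝ 1 F1 D ∧ ContDiffOn ℝ 1 F2 D ∧
    ∀ z ∈ D, ∀ J ∈ uS m, f (PhiJ J z) = F1 z + ιvA Ψ J * F2 z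

/-- The slice Cauchy–Riemann operator
`G = ∂_{x₀} + (x̲/|x̲|²) ∑_{j=1}^m x_j ∂_{x_j}`. -/
def Gop (Ψ : Cl m ≃ₐ[ℝ] A) (f : Vp m → A) (q : Vp m) : A :=
  fderiv ℝ f q (EuclideanSpace.single 0 1) +
    (‖pvec q‖ ^ 2)⁻¹ • (ιvA Ψ (pvec q) *
      ∑ j : Fin m, q j.succ • fderiv ℝ f q (EuclideanSpace.single j.succ 1))

/-- The Cauchy kernel `K(q,x) = 2 S^{-1}(q,x) / (ω_{m-1} |x̲|^{m-1})` for the slice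
Cauchy–Riemann operator. -/
def Kkernel (Ψ : Cl m ≃ₐ[ℝ] A) (q x : Vp m) : A :=
  (2 / (sphereArea m * ‖pvec x‖ ^ (m - 1))) • Skernel Ψ q x

/-- The Teodorescu transform `T_{Ω_D} f(q) = -(1/2π) ∫_{Ω_D} K(q,x) f(x) dV(x)`. -/
def Teo (Ψ : Cl m ≃ₐ[ℝ] A) (Ω : Set (Vp m)) (f : Vp m → A) (q : Vp m) : A :=
  -(2 * π)⁻¹ • ∫ x in Ω, Kkernel Ψ q x * f x

/-- The slice Teodorescu transform
`T_{Ω_I} f(q) = -(1/2π) ∫_{Ω_I} S^{-1}(q,x) f(x) dV_I(x)`, the plane `Ω_I = Ω ∩ ℂ_I` being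
equipped with the two-dimensional (Hausdorff) area measure. -/
def TeoSlice (Ψ : Cl m ≃ₐ[ℝ] A) (Ω : Set (Vp m)) (I : EuclideanSpace ℝ (Fin m))
    (f : Vp m → A) (q : Vp m) : A :=
  -(2 * π)⁻¹ • ∫ x in Ω ∩ planeC I, Skernel Ψ q x * f x ∂μH[2]

/-- The boundary integral operator
`F_{∂Ω_D} f(q) = (1/2π) ∫_{∂Ω_D} K(q,x) n(x) f(x) dσ(x)`, the boundary being equipped with
the `m`-dimensional (Hausdorff) area measure and `n` the outward unit normal computed from a
defining function `ρ`. -/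
def Fbd (Ψ : Cl m ≃ₐ[ℝ] A) (Ω : Set (Vp m)) (ρ : Vp m → ℝ) (f : Vp m → A) (q : Vp m) : A :=
  (2 * π)⁻¹ • ∫ x in frontier Ω, Kkernel Ψ q x * embA Ψ (outNormal ρ x) * f x ∂μH[m]

/-- `c` is the principal value `p.v.(1/2π) ∫_{∂Ω_D} K(q,x) n(x) f(x) dσ(x)`, i.e. the singular
boundary operator `S_{∂Ω_D} f(q)` equals `c`. -/
def SbdEq (Ψ : Cl m ≃ₐ[ℝ] A) (Ω : Set (Vp m)) (ρ : Vp m → ℝ) (f : Vp m → A) (q : Vp m)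
    (c : A) : Prop :=
  Tendsto (fun ε : ℝ =>
      (2 * π)⁻¹ • ∫ x in (frontier Ω) \ Metric.ball q ε,
        Kkernel Ψ q x * embA Ψ (outNormal ρ x) * f x ∂μH[m])
    (𝓝[>] 0) (𝓝 c)

/-- `f` is Hölder continuous on `s`. -/
def IsHolderOn (f : Vp m → A) (s : Set (Vp m)) : Prop :=
  ∃ (C ν : ℝ≥0), 0 < ν ∧ HolderOnWith C ν f s

/-- `F` has non-tangential limit `c` at the boundary point `q` of `Ω`: along every path in `Ω`
approaching `q` non-tangentially, `F` tends to `c`. -/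
def NTLimit (F : Vp m → A) (Ω : Set (Vp m)) (q : Vp m) (c : A) : Prop :=
  ∀ y : ℝ → Vp m, (∀ t, 0 < t → y t ∈ Ω) → Tendsto y (𝓝[>] 0) (𝓝 q) →
    (∃ κ > 0, ∀ t, 0 < t → dist (y t) q ≤ κ * Metric.infDist (y t) (frontier Ω)) →
    Tendsto (fun t => F (y t)) (𝓝[>] 0) (𝓝 c)


/-- Iterated partial derivative `∂^n_{q_i}` in the coordinate direction `i`. -/
def pdIter (i : Fin (m + 1)) : ℕ → (Vp m → A) → (Vp m → A)
  | 0, f => f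
  | n + 1, f => fun q => fderiv ℝ (pdIter i n f) q (EuclideanSpace.single i 1)

/-- The iterated partial derivative `∇^l = ∂^{l_0}_{q_0} ⋯ ∂^{l_m}_{q_m}` associated with a
multi-index `l ∈ ℕ^{m+1}`. -/
def multiPD (l : Fin (m + 1) → ℕ) (f : Vp m → A) : Vp m → A :=
  Fin.foldr (m + 1) (fun i g => pdIter i (l i) g) f

end Analytic

section Algebra
variable [Ring A] [Algebra ℝ A]

theorem ιvA_smul (Ψ : Cl m ≃ₐ[ℝ] A) (c : ℝ) (v : EuclideanSpace ℝ (Fin m)) :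
    ιvA Ψ (c • v) = c • ιvA Ψ v := by
  have h : (fun i => (c • v) i) = c • (fun i => v i) := rfl
  simp only [ιvA, h, map_smul]

theorem ιvA_mul_self (Ψ : Cl m ≃ₐ[ℝ] A) (v : EuclideanSpace ℝ (Fin m)) :
    ιvA Ψ v * ιvA Ψ v = (-‖v‖ ^ 2) • (1 : A) := by
  have h : clQ m (fun i => v i) = -‖v‖ ^ 2 := by
    rw [EuclideanSpace.real_norm_sq_eq]
    simp [clQ, QuadraticMap.weightedSumSquares_apply, sq]
  rw [ιvA, ← map_mul, CliffordAlgebra.ι_sq_scalar, h, AlgEquiv.commutes,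
    Algebra.algebraMap_eq_smul_one]

theorem pre_PhiJ (J : EuclideanSpace ℝ (Fin m)) (z : ℂ) : pre (PhiJ J z) = z.re := rfl

theorem pvec_PhiJ (J : EuclideanSpace ℝ (Fin m)) (z : ℂ) : pvec (PhiJ J z) = z.im • J := rfl

/-- In the plane spanned by `1` and `J` with `J² = -1`, the inverse of `a + b J` is
`(a - b J) / (a² + b²)`. -/
theorem ringInverse_smul_one_add_smul {J : A} (hJ : J * J = -1) {a b : ℝ}
    (h : a ^ 2 + b ^ 2 ≠ 0) :
    Ring.inverse (a • (1 : A) + b • J) = (a ^ 2 + b ^ 2)⁻¹ • (a • (1 : A) - b • J) := by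
  refine Ring.inverse_unit
    (⟨a • 1 + b • J, (a ^ 2 + b ^ 2)⁻¹ • (a • (1 : A) - b • J), ?_, ?_⟩ : Aˣ)
  all_goals
    simp only [mul_add, add_mul, mul_sub, sub_mul, smul_mul_assoc, mul_smul_comm, mul_one, one_mul,
      hJ]
    match_scalars <;> field_simp <;> ring

/-- Partial fractions for the slice Cauchy kernel, in the algebra generated by two square roots
`J`, `K` of `-1`. -/
theorem slice_kernel_partial_fractions {J K : A} (hJ : J * J = -1) (hK : K * K = -1)
    {p ζ v : ℝ} (h₁ : p ^ 2 + (v - ζ) ^ 2 ≠ 0) (h₂ : p ^ 2 + (v + ζ) ^ 2 ≠ 0) :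
    -(Ring.inverse ((p ^ 2 - ζ ^ 2 + v ^ 2) • (1 : A) + (2 * p * ζ) • J) *
        (p • (1 : A) + ζ • J + v • K)) =
      ((2 : ℝ)⁻¹ • (1 - J * K)) *
          ((p ^ 2 + (v - ζ) ^ 2)⁻¹ • ((-p) • (1 : A) - (v - ζ) • K)) +
        ((2 : ℝ)⁻¹ • (1 + J * K)) *
          ((p ^ 2 + (v + ζ) ^ 2)⁻¹ • ((-p) • (1 : A) - (v + ζ) • K)) := by
  have hN : (p ^ 2 - ζ ^ 2 + v ^ 2) ^ 2 + (2 * p * ζ) ^ 2 =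
      (p ^ 2 + (v - ζ) ^ 2) * (p ^ 2 + (v + ζ) ^ 2) := by ring
  have hJKK : J * K * K = -J := by rw [mul_assoc, hK, mul_neg_one]
  rw [ringInverse_smul_one_add_smul hJ (hN ▸ mul_ne_zero h₁ h₂), hN]
  simp only [mul_add, add_mul, mul_sub, sub_mul, smul_mul_assoc, mul_smul_comm, mul_one, one_mul,
    hJ, hJKK]
  match_scalars <;> field_simp <;> ring

theorem embC_inv (Ψ : Cl m ≃ₐ[ℝ] A) (I : EuclideanSpace ℝ (Fin m)) (w : ℂ) :
    embC Ψ I w⁻¹ = (w.re ^ 2 + w.im ^ 2)⁻¹ • (w.re • (1 : A) - w.im • ιvA Ψ I) := by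
  rw [embC, Complex.inv_re, Complex.inv_im, Complex.normSq_apply, Algebra.algebraMap_eq_smul_one]
  match_scalars <;> ring

end Algebra

/-- Splitting of the slice Cauchy kernel on a slice plane: for `q = q₀ + I_q ζ ∈ ℝ^{m+1}_*`
(`ζ = |q̲| > 0`), `I ∈ 𝕊` and `x = Φ_I(z) ∈ ℂ_I` with `x ∉ {q_I, q_{-I}}`,
`S⁻¹(q, x) = α (x - q_I)⁻¹ + β (x - q_{-I})⁻¹`, where `α = (1 - I_q I)/2`,
`β = (1 + I_q I)/2` and the inverses are taken in the plane `ℂ_I ≅ ℂ`. -/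
theorem slice_cauchy_kernel_splitting {m : ℕ} {A : Type*} [Ring A] [Algebra ℝ A] (Ψ : Cl m ≃ₐ[ℝ] A)
    (q : Vp m) (hq : pvec q ≠ 0)
    (I : EuclideanSpace ℝ (Fin m)) (hI : I ∈ uS m)
    (z : ℂ) (hz1 : z ≠ ⟨pre q, ‖pvec q‖⟩) (hz2 : z ≠ ⟨pre q, -‖pvec q‖⟩) :
    Skernel Ψ q (PhiJ I z) =
      ((2 : ℝ)⁻¹ • (1 - ιvA Ψ (‖pvec q‖⁻¹ • pvec q) * ιvA Ψ I)) *
          embC Ψ I ((z - ⟨pre q, ‖pvec q‖⟩)⁻¹) +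
        ((2 : ℝ)⁻¹ • (1 + ιvA Ψ (‖pvec q‖⁻¹ • pvec q) * ιvA Ψ I)) *
          embC Ψ I ((z - ⟨pre q, -‖pvec q‖⟩)⁻¹) := by
  have hζ : ‖pvec q‖ ≠ 0 := norm_ne_zero_iff.mpr hq
  have hI1 : ‖I‖ = 1 := mem_sphere_zero_iff_norm.mp hI
  have hq' : pvec q = ‖pvec q‖ • (‖pvec q‖⁻¹ • pvec q) := (smul_inv_smul₀ hζ _).symm
  have hunit : ‖‖pvec q‖⁻¹ • pvec q‖ = 1 := by
    rw [norm_smul, norm_inv, norm_norm, inv_mul_cancel₀ hζ]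
  have hK : ιvA Ψ I * ιvA Ψ I = -1 := by rw [ιvA_mul_self, hI1]; simp
  have hJ : ιvA Ψ (‖pvec q‖⁻¹ • pvec q) * ιvA Ψ (‖pvec q‖⁻¹ • pvec q) = -1 := by
    rw [ιvA_mul_self, hunit]; simp
  have hqJ : ιvA Ψ (pvec q) = ‖pvec q‖ • ιvA Ψ (‖pvec q‖⁻¹ • pvec q) := by
    rw [← ιvA_smul, ← hq']
  have hne (t : ℝ) (h : z ≠ ⟨pre q, t⟩) : (pre q - z.re) ^ 2 + (z.im - t) ^ 2 ≠ 0 := by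
    intro h0
    refine h (Complex.ext ?_ ?_) <;> simp only <;>
      nlinarith [sq_nonneg (pre q - z.re), sq_nonneg (z.im - t)]
  have h₁ := hne _ hz1
  have h₂ := hne _ hz2
  rw [sub_neg_eq_add] at h₂
  have key := slice_kernel_partial_fractions hJ hK h₁ h₂
  rw [Skernel, embA, embConjA, pre_PhiJ, pvec_PhiJ, norm_smul, hI1, mul_one, Real.norm_eq_abs,
    sq_abs, ιvA_smul, embC_inv, embC_inv, hqJ]
  generalize ιvA Ψ (‖pvec q‖⁻¹ • pvec q) = J at *
  generalize ιvA Ψ I = K at *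
  convert key using 3
  · congr 1
    simp only [sq (_ + _ : A), Algebra.algebraMap_eq_smul_one, mul_add, add_mul, smul_mul_assoc,
      mul_smul_comm, mul_one, one_mul, hJ]
    match_scalars <;> ring
  · simp only [Algebra.algebraMap_eq_smul_one]
    match_scalars <;> ring
  all_goals simp [sub_sq_comm z.re]

end
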